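/- Let p be a prime, let n, d, m ≥ 1, let ε > 0, let f : {0,1}^n → {0,1}, and let F_1, …, F_m be polynomials over 𝔽_p of degree at most d, each taking values in {0,1} ⊆ 𝔽_p on every point of {0,1}^n, such that for every x ∈ {0,1}^n the number of indices i ∈ {1,…,m} with F_i(x) ≠ f(x) is at most 2εm. Then for every integer k ≥ 1 with p^{-k} ≤ ε/m, there exists a torus polynomial of degree at most (2k−1)·d that 3ε-approximates f. -/

import Mathlib

open Finset

noncomputable section

/-- The one-dimensional torus `ℝ/ℤ`. -/
abbrev 𝕋 := AddCircle (1 : ℝ)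

/-- Real value of a Boolean input bit. -/
def bval {n : ℕ} (x : Fin n → Bool) (i : Fin n) : ℝ := if x i then 1 else 0

/-- Hamming weight of a Boolean input. -/
def wt {n : ℕ} (x : Fin n → Bool) : ℕ := ∑ i, if x i then 1 else 0

/-- `P` is a torus polynomial of degree at most `d` in `n` variables. -/
def IsTorusPoly {n : ℕ} (d : ℕ) (P : (Fin n → Bool) → 𝕋) : Prop :=
  ∃ c : Finset (Fin n) → ℝ, (∀ S, d < S.card → c S = 0) ∧
    ∀ x, P x = ((∑ S : Finset (Fin n), c S * ∏ i ∈ S, bval x i : ℝ) : 𝕋)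

/-- `P` ε-approximates the Boolean function `f`. -/
def Approx {n : ℕ} (P : (Fin n → Bool) → 𝕋) (f : (Fin n → Bool) → Bool) (ε : ℝ) : Prop :=
  ∀ x, ‖P x - (((if f x then 1 else 0) / 2 : ℝ) : 𝕋)‖ ≤ ε

open MvPolynomial in
/-- A real polynomial of total degree at most `D` restricts to a torus polynomial on the cube. -/
theorem isTorusPoly_of_totalDegree_le {n D : ℕ} (Q : MvPolynomial (Fin n) ℝ)
    (hQ : Q.totalDegree ≤ D) :
    IsTorusPoly D (fun x => ((eval (bval x) Q : ℝ) : 𝕋)) := by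
  classical
  refine ⟨fun S => ∑ s ∈ Q.support with s.support = S, coeff s Q, ?_, ?_⟩
  · intro S hS
    refine Finset.sum_eq_zero fun s hs => ?_
    rw [Finset.mem_filter] at hs
    have h1 : s.support.card ≤ s.sum fun _ e => e := by
      rw [Finsupp.sum, Finset.card_eq_sum_ones]
      exact Finset.sum_le_sum fun i hi => Nat.one_le_iff_ne_zero.2 (Finsupp.mem_support_iff.1 hi)
    have h2 := le_totalDegree hs.1
    rw [hs.2] at h1
    omega
  · intro x
    refine congrArg (fun a : ℝ => (a : 𝕋)) ?_
    rw [eval_eq]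
    simp_rw [Finset.sum_mul]
    rw [← Finset.sum_fiberwise (s := Q.support) (g := fun s => s.support)]
    refine Finset.sum_congr rfl fun S _ => Finset.sum_congr rfl fun s hs => ?_
    rw [Finset.mem_filter] at hs
    rw [← hs.2]
    congr 1
    refine Finset.prod_congr rfl fun i hi => ?_
    unfold bval
    split_ifs
    · simp
    · exact zero_pow (Finsupp.mem_support_iff.1 hi)

open Polynomial in
/-- Beigel–Tarui modulus amplification. -/
theorem exists_modulus_amplifier (k : ℕ) (hk : 1 ≤ k) :
    ∃ A : ℤ[X], A.natDegree ≤ 2 * k - 1 ∧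
      ∀ q t : ℤ, (q ∣ t → q ^ k ∣ A.eval t) ∧ (q ∣ t - 1 → q ^ k ∣ A.eval t - 1) := by
  have hcop : IsCoprime (X : ℤ[X]) (X - C 1) := ⟨1, -1, by simp⟩
  obtain ⟨u, v, huv⟩ := hcop.pow (m := k) (n := k)
  have hM1 : ((X : ℤ[X]) ^ k).Monic := monic_X_pow k
  have hM2 : ((X - C 1 : ℤ[X]) ^ k).Monic := (monic_X_sub_C 1).pow k
  have hM := hM1.mul hM2
  set M : ℤ[X] := X ^ k * (X - C 1) ^ k with hMdef
  have hdegM : M.natDegree = 2 * k := by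
    rw [hMdef, hM1.natDegree_mul hM2, natDegree_X_pow, (monic_X_sub_C (1 : ℤ)).natDegree_pow,
      natDegree_X_sub_C]
    ring
  have hdiv := modByMonic_add_div (u * X ^ k) M
  refine ⟨(u * X ^ k) %ₘ M, ?_, fun q t => ⟨fun h => ?_, fun h => ?_⟩⟩
  · have := natDegree_modByMonic_lt (u * X ^ k) hM (by
      intro h
      rw [h] at hdegM
      simp at hdegM
      omega)
    omega
  · have hA : (u * X ^ k) %ₘ M = X ^ k * (u - (X - C 1) ^ k * ((u * X ^ k) /ₘ M)) := by
      linear_combination hdiv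
    rw [hA, eval_mul, eval_pow, eval_X]
    exact (pow_dvd_pow_of_dvd h k).mul_right _
  · have hA : (u * X ^ k) %ₘ M - C 1 = (X - C 1) ^ k * (- v - X ^ k * ((u * X ^ k) /ₘ M)) := by
      have : (C 1 : ℤ[X]) = 1 := C_1
      linear_combination hdiv + huv - this
    have h' := congrArg (eval t) hA
    rw [eval_sub, eval_C] at h'
    rw [h', eval_mul, eval_pow, eval_sub, eval_X, eval_C]
    exact (pow_dvd_pow_of_dvd h k).mul_right _

open MvPolynomial in
/-- Polynomials over `ZMod p` lift to integer polynomials without increasing the total degree. -/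
theorem exists_int_lift {σ : Type*} (p : ℕ) [NeZero p] (F : MvPolynomial σ (ZMod p)) :
    ∃ G : MvPolynomial σ ℤ, map (Int.castRingHom (ZMod p)) G = F ∧
      G.totalDegree ≤ F.totalDegree := by
  refine ⟨∑ s ∈ F.support, monomial s ((coeff s F).val : ℤ), ?_, ?_⟩
  · rw [map_sum]
    conv_rhs => rw [F.as_sum]
    refine Finset.sum_congr rfl fun s _ => ?_
    simp [map_monomial]
  · refine totalDegree_finsetSum_le fun s hs => ?_
    exact (totalDegree_monomial_le _ _).trans (le_totalDegree hs)

open MvPolynomial in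
theorem totalDegree_aeval_le {σ R : Type*} [CommRing R] (A : Polynomial R)
    (G : MvPolynomial σ R) :
    (Polynomial.aeval G A).totalDegree ≤ A.natDegree * G.totalDegree := by
  rw [Polynomial.aeval_eq_sum_range]
  refine totalDegree_finsetSum_le fun i hi => ?_
  refine (totalDegree_smul_le _ _).trans ((totalDegree_pow _ _).trans ?_)
  exact Nat.mul_le_mul_right _ (by simpa [Nat.lt_succ_iff] using hi)

/-- Grid points of mesh `1 / N` approximate every real to within `1 / (2N)`. -/
theorem exists_int_div_near (N y : ℝ) (hN : 0 < N) :
    ∃ c : ℤ, |c / N - y| ≤ N⁻¹ / 2 := by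
  refine ⟨round (y * N), ?_⟩
  have h := abs_sub_round (y * N)
  have e : (round (y * N) : ℝ) / N - y = -(y * N - round (y * N)) * N⁻¹ := by
    field_simp
    ring
  rw [e, abs_mul, abs_neg, abs_of_pos (inv_pos.2 hN)]
  have := mul_le_mul_of_nonneg_right h (inv_pos.2 hN).le
  linarith

/-- A representative within `ε` of an integer has norm at most `ε` in `ℝ/ℤ`. -/
theorem norm_coe_torus_le {a ε : ℝ} (N : ℤ) (h : |a - N| ≤ ε) : ‖(a : 𝕋)‖ ≤ ε := by
  have h1 : ‖(a : 𝕋)‖ = |a - round a| := UnitAddCircle.norm_eq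
  rw [h1]
  exact (round_le a N).trans h

open MvPolynomial in
theorem map_eval_eq_eval_map {σ R S : Type*} [CommSemiring R] [CommSemiring S] (φ : R →+* S)
    (z : σ → R) (G : MvPolynomial σ R) :
    φ (eval z G) = eval (fun j => φ (z j)) (map φ G) := by
  rw [eval_map]
  exact (eval₂_comp φ z G).trans rfl

/-- if each point is miscomputed by at most `2εm` of the `m` polynomials
`F_1,…,F_m` over `𝔽_p` (of degree ≤ d, Boolean-valued on the cube), then for every
`k ≥ 1` with `p^{-k} ≤ ε/m` there is a torus polynomial of degree at most `(2k−1)·d`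
that `3ε`-approximates `f`. -/
theorem stmt_3 (p n d m : ℕ) (hp : p.Prime) (hn : 1 ≤ n) (hd : 1 ≤ d) (hm : 1 ≤ m)
    (ε : ℝ) (hε : 0 < ε) (f : (Fin n → Bool) → Bool)
    (F : Fin m → MvPolynomial (Fin n) (ZMod p))
    (hdeg : ∀ i, (F i).totalDegree ≤ d)
    (hrange : ∀ i (x : Fin n → Bool),
      MvPolynomial.eval (fun j => if x j then (1 : ZMod p) else 0) (F i) = 0 ∨
      MvPolynomial.eval (fun j => if x j then (1 : ZMod p) else 0) (F i) = 1)
    (herr : ∀ x : Fin n → Bool,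
      ((univ.filter (fun i =>
        MvPolynomial.eval (fun j => if x j then (1 : ZMod p) else 0) (F i)
          ≠ (if f x then 1 else 0))).card : ℝ) ≤ 2 * ε * m)
    (k : ℕ) (hk : 1 ≤ k) (hpk : ((p : ℝ) ^ k)⁻¹ ≤ ε / m) :
    ∃ P : (Fin n → Bool) → 𝕋, IsTorusPoly ((2 * k - 1) * d) P ∧ Approx P f (3 * ε) := by
  classical
  have : NeZero p := ⟨hp.ne_zero⟩
  obtain ⟨A, hAdeg, hA⟩ := exists_modulus_amplifier k hk
  choose G hGmap hGdeg using fun i => exists_int_lift p (F i)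
  have hmR : (0 : ℝ) < m := by exact_mod_cast hm
  have hpR : (0 : ℝ) < (p : ℝ) ^ k := pow_pos (by exact_mod_cast hp.pos) k
  obtain ⟨c, hc⟩ := exists_int_div_near ((p : ℝ) ^ k) (1 / (2 * m)) hpR
  set r : ℝ := c / (p : ℝ) ^ k with hr
  let H : MvPolynomial (Fin n) ℤ := ∑ i, Polynomial.aeval (G i) A
  have hHdeg : H.totalDegree ≤ (2 * k - 1) * d :=
    MvPolynomial.totalDegree_finsetSum_le fun i _ =>
      (totalDegree_aeval_le A (G i)).trans
        (Nat.mul_le_mul hAdeg ((hGdeg i).trans (hdeg i)))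
  let Q : MvPolynomial (Fin n) ℝ := r • MvPolynomial.map (Int.castRingHom ℝ) H
  have hQdeg : Q.totalDegree ≤ (2 * k - 1) * d :=
    (MvPolynomial.totalDegree_smul_le _ _).trans
      ((Finset.sup_mono (MvPolynomial.support_map_subset _ _)).trans hHdeg)
  refine ⟨_, isTorusPoly_of_totalDegree_le Q hQdeg, fun x => ?_⟩
  let z : Fin n → ℤ := fun j => if x j then 1 else 0
  let b : Fin n → ZMod p := fun j => if x j then 1 else 0
  let s : ℕ := (univ.filter fun i => MvPolynomial.eval b (F i) = 1).card
  have hFG : ∀ i, ((MvPolynomial.eval z (G i) : ℤ) : ZMod p) = MvPolynomial.eval b (F i) := by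
    intro i
    have h := map_eval_eq_eval_map (Int.castRingHom (ZMod p)) z (G i)
    rw [hGmap] at h
    refine h.trans ?_
    congr 2
    funext j
    simp only [z, b]
    split_ifs <;> simp
  have hp1 : (0 : ZMod p) ≠ 1 := by
    have := Fact.mk hp
    exact zero_ne_one
  have hterm : ∀ i, (p : ℤ) ^ k ∣ A.eval (MvPolynomial.eval z (G i)) -
      (if MvPolynomial.eval b (F i) = 1 then 1 else 0) := by
    intro i
    rcases hrange i x with h | h
    · change MvPolynomial.eval b (F i) = 0 at h
      rw [h, if_neg hp1, sub_zero]
      refine (hA p _).1 ((ZMod.intCast_zmod_eq_zero_iff_dvd _ p).1 ?_)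
      rw [hFG, h]
    · change MvPolynomial.eval b (F i) = 1 at h
      rw [h, if_pos rfl]
      refine (hA p _).2 ((ZMod.intCast_zmod_eq_zero_iff_dvd _ p).1 ?_)
      rw [Int.cast_sub, hFG, h, Int.cast_one, sub_self]
  obtain ⟨e, he⟩ : (p : ℤ) ^ k ∣ MvPolynomial.eval z H - s := by
    have h := Finset.dvd_sum fun i (_ : i ∈ univ) => hterm i
    rw [Finset.sum_sub_distrib, Finset.sum_boole] at h
    have hH : MvPolynomial.eval z H = ∑ i, A.eval (MvPolynomial.eval z (G i)) := by
      rw [map_sum]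
      refine Finset.sum_congr rfl fun i _ => ?_
      rw [Polynomial.aeval_def, Polynomial.hom_eval₂, Polynomial.eval,
        RingHom.ext_int ((MvPolynomial.eval z).comp _) (RingHom.id ℤ)]
    rw [hH]
    exact h
  have hQ : MvPolynomial.eval (bval x) Q = r * s + (c * e : ℤ) := by
    have h := map_eval_eq_eval_map (Int.castRingHom ℝ) z H
    have hz : (fun j => Int.castRingHom ℝ (z j)) = bval x := by
      funext j
      simp only [z, bval]
      split_ifs <;> simp
    have he' : ((MvPolynomial.eval z H : ℤ) : ℝ) = s + (p : ℝ) ^ k * e := by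
      have h2 := congrArg (Int.cast : ℤ → ℝ) he
      push_cast at h2
      linarith
    rw [hz, eq_intCast, he'] at h
    rw [MvPolynomial.smul_eval, ← h, hr]
    push_cast
    field_simp
  have hsm : (s : ℝ) ≤ m := by
    have h : s ≤ m := (Finset.card_filter_le _ _).trans (by simp)
    exact_mod_cast h
  have hs0 : (0 : ℝ) ≤ s := Nat.cast_nonneg s
  have hround : |r * s - 1 / (2 * (m : ℝ)) * s| ≤ ε := by
    rw [← sub_mul, abs_mul, abs_of_nonneg hs0]
    calc |r - 1 / (2 * m)| * s ≤ (ε / m) * m :=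
          mul_le_mul (hc.trans (by have := inv_pos.2 hpR; linarith)) hsm hs0 (by positivity)
      _ = ε := by field_simp
  have hcount : |1 / (2 * (m : ℝ)) * s - (if f x then 1 else 0) / 2| ≤ ε := by
    have herrx := herr x
    change ((univ.filter fun i => MvPolynomial.eval b (F i) ≠ _).card : ℝ) ≤ _ at herrx
    by_cases hfx : f x
    · simp only [hfx, if_true] at herrx ⊢
      have hsplit : (s : ℝ) +
          ((univ.filter fun i => MvPolynomial.eval b (F i) ≠ 1).card : ℝ) = m := by
        have h := Finset.card_filter_add_card_filter_not (s := (univ : Finset (Fin m)))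
          (fun i => MvPolynomial.eval b (F i) = 1)
        rw [Finset.card_univ, Fintype.card_fin] at h
        exact_mod_cast h
      have e1 : 1 / (2 * (m : ℝ)) * s - 1 / 2 = -((m - s) / (2 * m)) := by
        field_simp
        ring
      rw [e1, abs_neg, abs_of_nonneg (div_nonneg (by linarith) (by positivity)),
        div_le_iff₀ (by positivity)]
      linarith
    · simp only [hfx] at herrx ⊢
      have hfil : (univ.filter fun i => MvPolynomial.eval b (F i) ≠ 0) =
          univ.filter fun i => MvPolynomial.eval b (F i) = 1 := by
        refine Finset.filter_congr fun i _ => ⟨fun h => (hrange i x).resolve_left h, fun h => ?_⟩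
        rw [h]
        exact hp1.symm
      have hs : (s : ℝ) ≤ 2 * ε * m := by
        simpa [hfil] using herrx
      have e1 : 1 / (2 * (m : ℝ)) * s = s / (2 * m) := by ring
      simp only [Bool.false_eq_true, if_false, zero_div, sub_zero]
      rw [e1, abs_of_nonneg (by positivity), div_le_iff₀ (by positivity)]
      linarith
  change ‖((MvPolynomial.eval (bval x) Q : ℝ) : 𝕋) - _‖ ≤ _
  rw [← AddCircle.coe_sub, hQ]
  refine norm_coe_torus_le (c * e) ?_
  have htri := abs_add_le (r * s - 1 / (2 * m) * s) (1 / (2 * m) * s - (if f x then 1 else 0) / 2)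
  rw [show r * s + (c * e : ℤ) - (if f x then (1 : ℝ) else 0) / 2 - (c * e : ℤ) =
    (r * s - 1 / (2 * m) * s) + (1 / (2 * m) * s - (if f x then 1 else 0) / 2) by ring]
  linarith
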